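/- Define the affine isometry φ_i : E → E by φ_i(γ) = kλ_i + τ_i(γ). Then φ_i normalizes the quantum Weyl group W₀: for every σ ∈ W₀ one has φ_i ∘ σ ∘ φ_i^{−1} ∈ W₀, and the linear part of φ_i ∘ σ ∘ φ_i^{−1} has the same determinant (±1) as the linear part of σ. -/

import Mathlib

open scoped RealInnerProductSpace

noncomputable section

/-- An irreducible reduced crystallographic root system in a finite-dimensional real
inner product space, normalized so that long roots have squared length `2`, together
with a chosen base `α`, the half-sum `ρ` of the positive roots, the highest root `θ`,
and the fundamental weights `fw`. -/
structure RootSystemData (E : Type) [NormedAddCommGroup E] [InnerProductSpace ℝ E]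
    [FiniteDimensional ℝ E] : Type where
  Φ : Finset E
  r : ℕ
  α : Fin r → E
  ρ : E
  θ : E
  fw : Fin r → E
  nonzero : ∀ β ∈ Φ, β ≠ (0 : E)
  spans : Submodule.span ℝ (Φ : Set E) = ⊤
  reflect_mem : ∀ β ∈ Φ, ∀ γ ∈ Φ, γ - (2 * ⟪γ, β⟫ / ⟪β, β⟫) • β ∈ Φ
  integral : ∀ β ∈ Φ, ∀ γ ∈ Φ, ∃ n : ℤ, 2 * ⟪γ, β⟫ / ⟪β, β⟫ = (n : ℝ)
  reduced : ∀ β ∈ Φ, ∀ t : ℝ, t • β ∈ Φ → t = 1 ∨ t = -1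
  irred : ¬ ∃ Φ₁ Φ₂ : Finset E, Φ₁.Nonempty ∧ Φ₂.Nonempty ∧ Disjoint Φ₁ Φ₂ ∧
      (∀ β, β ∈ Φ ↔ β ∈ Φ₁ ∨ β ∈ Φ₂) ∧ ∀ a ∈ Φ₁, ∀ b ∈ Φ₂, ⟪a, b⟫ = 0
  long_le : ∀ β ∈ Φ, ⟪β, β⟫ ≤ 2
  long_exists : ∃ β ∈ Φ, ⟪β, β⟫ = 2
  base_mem : ∀ i, α i ∈ Φ
  base_indep : LinearIndependent ℝ α
  base_spans : Submodule.span ℝ (Set.range α) = ⊤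
  base_coeffs : ∀ β ∈ Φ, ∃ c : Fin r → ℤ, β = ∑ i, (c i : ℝ) • α i ∧
      ((∀ i, 0 ≤ c i) ∨ (∀ i, c i ≤ 0))
  ρ_def : ∃ P : Finset E,
      (∀ β, β ∈ P ↔ β ∈ Φ ∧ ∃ c : Fin r → ℕ, β = ∑ i, (c i : ℝ) • α i) ∧
      ρ = (2 : ℝ)⁻¹ • ∑ β ∈ P, β
  θ_mem : θ ∈ Φ
  θ_pos : ∃ c : Fin r → ℕ, θ = ∑ i, (c i : ℝ) • α i
  θ_highest : ∀ β ∈ Φ, ∃ c : Fin r → ℝ, (∀ i, 0 ≤ c i) ∧ θ - β = ∑ i, c i • α i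
  fw_def : ∀ i j, ⟪fw i, α j⟫ = if i = j then ⟪α j, α j⟫ / 2 else 0

variable {E : Type} [NormedAddCommGroup E] [InnerProductSpace ℝ E] [FiniteDimensional ℝ E]

/-- The Weyl group: the subgroup of linear automorphisms of `E` generated by the
reflections in the roots (each such reflection is automatically orthogonal). -/
def weylGroup (D : RootSystemData E) : Subgroup (E ≃ₗ[ℝ] E) :=
  Subgroup.closure {f | ∃ β ∈ D.Φ, ∀ x, f x = x - (2 * ⟪x, β⟫ / ⟪β, β⟫) • β}

/-- The quantum Weyl group at level `k`: the group of affine isometries of `E` generated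
by the affine reflections `x ↦ x - (2(x+ρ,αⱼ)/(αⱼ,αⱼ))αⱼ` and `x ↦ x - ((x,θ)-(k+1))θ`. -/
def qWeylGroup (D : RootSystemData E) (k : ℕ) : Subgroup (E ≃ᵃⁱ[ℝ] E) :=
  Subgroup.closure
    ({f | ∃ j : Fin D.r, ∀ x, f x = x - (2 * ⟪x + D.ρ, D.α j⟫ / ⟪D.α j, D.α j⟫) • D.α j} ∪
     {f | ∀ x, f x = x - (⟪x, D.θ⟫ - (k + 1)) • D.θ})

/-- The basis of simple roots. -/
def sBasis (D : RootSystemData E) : Module.Basis (Fin D.r) ℝ E :=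
  Module.Basis.mk D.base_indep D.base_spans.ge

lemma sBasis_apply (D : RootSystemData E) (j : Fin D.r) : sBasis D j = D.α j := by
  simp [sBasis]

lemma coord_sum (D : RootSystemData E) (c : Fin D.r → ℝ) (j : Fin D.r) :
    (sBasis D).coord j (∑ i, c i • D.α i) = c j := by
  simp only [← sBasis_apply, Module.Basis.coord_apply, Module.Basis.repr_sum_self]

lemma coord_simple (D : RootSystemData E) (i j : Fin D.r) :
    (sBasis D).coord j (D.α i) = if i = j then 1 else 0 := by
  rw [← sBasis_apply, Module.Basis.coord_apply, Module.Basis.repr_self, Finsupp.single_apply]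

lemma root_inner_ne (D : RootSystemData E) {β : E} (h : β ∈ D.Φ) : ⟪β, β⟫ ≠ 0 :=
  inner_self_ne_zero.mpr (D.nonzero β h)

lemma root_neg (D : RootSystemData E) {β : E} (h : β ∈ D.Φ) : -β ∈ D.Φ := by
  have := D.reflect_mem β h β h
  rw [mul_div_assoc, div_self (root_inner_ne D h)] at this
  convert this using 1
  module

lemma rho_pair (D : RootSystemData E) (j : Fin D.r) :
    ⟪D.ρ, D.α j⟫ = ⟪D.α j, D.α j⟫ / 2 := by
  classical
  obtain ⟨P, hP, hρ⟩ := D.ρ_def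
  have hne := root_inner_ne D (D.base_mem j)
  have hjP : D.α j ∈ P := by
    rw [hP]
    refine ⟨D.base_mem j, fun i => if i = j then 1 else 0, ?_⟩
    simp
  have hneg : -D.α j ∉ P := by
    rw [hP]
    rintro ⟨_, c, hc⟩
    have := congrArg ((sBasis D).coord j) hc
    rw [coord_sum, map_neg, coord_simple] at this
    simp only [if_true] at this
    have h2 : (0 : ℝ) ≤ (c j : ℝ) := Nat.cast_nonneg _
    linarith
  have key : ∑ β ∈ P.erase (D.α j), ⟪β, D.α j⟫ = 0 := by
    refine Finset.sum_involution
      (fun β _ => β - (2 * ⟪β, D.α j⟫ / ⟪D.α j, D.α j⟫) • D.α j) ?_ ?_ ?_ ?_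
    · intro β _
      simp only [inner_sub_left, real_inner_smul_left]
      field_simp
      ring
    · intro β _ h0 heq
      have h1 : (2 * ⟪β, D.α j⟫ / ⟪D.α j, D.α j⟫) • D.α j = 0 := by
        simpa using heq
      rcases smul_eq_zero.mp h1 with h | h
      · rw [div_eq_zero_iff] at h
        rcases h with h | h
        · exact h0 (by linarith)
        · exact hne h
      · exact D.nonzero _ (D.base_mem j) h
    · intro β hβ
      obtain ⟨hβj, hβP⟩ := Finset.mem_erase.mp hβ
      obtain ⟨hβΦ, c, hc⟩ := (hP β).mp hβP
      have hs := D.reflect_mem _ (D.base_mem j) β hβΦ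
      set t := 2 * ⟪β, D.α j⟫ / ⟪D.α j, D.α j⟫ with ht
      refine Finset.mem_erase.mpr ⟨?_, ?_⟩
      · intro heq
        have h1 : β = (1 + t) • D.α j := by
          rw [add_smul, one_smul]; exact sub_eq_iff_eq_add.mp heq
        have h2 : t = 2 * (1 + t) := by
          conv_lhs => rw [ht, h1, real_inner_smul_left]
          field_simp
        have h3 : t = -2 := by linarith
        apply hneg
        have : β = -D.α j := by rw [h1, h3]; module
        rwa [← this]
      · obtain ⟨d, hd, hd0⟩ := D.base_coeffs _ hs
        rw [hP]
        refine ⟨hs, ?_⟩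
        rcases hd0 with hd0 | hd0
        · refine ⟨fun i => (d i).toNat, ?_⟩
          rw [hd]
          refine Finset.sum_congr rfl fun i _ => ?_
          congr 1
          have := Int.toNat_of_nonneg (hd0 i)
          exact_mod_cast this.symm
        · exfalso
          have hc0 : ∀ i, i ≠ j → c i = 0 := by
            intro i hi
            have := congrArg ((sBasis D).coord i) hd
            rw [coord_sum, map_sub, hc, coord_sum, map_smul, coord_simple,
              if_neg (Ne.symm hi)] at this
            have h1 : (d i : ℝ) ≤ 0 := by exact_mod_cast hd0 i
            have h2 : (c i : ℝ) ≤ 0 := by simp at this; linarith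
            have h3 : c i ≤ 0 := by exact_mod_cast h2
            omega
          have hb : β = (c j : ℝ) • D.α j := by
            rw [hc]
            refine Finset.sum_eq_single j (fun i _ hi => ?_) (by simp)
            rw [hc0 i hi]; simp
          rcases D.reduced _ (D.base_mem j) (c j) (hb ▸ hβΦ) with h | h
          · rw [h, one_smul] at hb
            exact hβj hb
          · have h2 : (0 : ℝ) ≤ (c j : ℝ) := Nat.cast_nonneg _
            linarith
    · intro β _
      simp only [inner_sub_left, real_inner_smul_left]
      have : 2 * (⟪β, D.α j⟫ - 2 * ⟪β, D.α j⟫ / ⟪D.α j, D.α j⟫ * ⟪D.α j, D.α j⟫) /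
          ⟪D.α j, D.α j⟫ = - (2 * ⟪β, D.α j⟫ / ⟪D.α j, D.α j⟫) := by
        field_simp
        ring
      rw [this]
      module
  rw [hρ, real_inner_smul_left, sum_inner, ← Finset.add_sum_erase _ _ hjP, key]
  ring

lemma weyl_mem (D : RootSystemData E) (f : E ≃ₗ[ℝ] E) (hf : f ∈ weylGroup D) :
    ∀ β ∈ D.Φ, f β ∈ D.Φ := by
  have hinv : ∀ g : E ≃ₗ[ℝ] E, (∀ β ∈ D.Φ, g β ∈ D.Φ) → ∀ β ∈ D.Φ, g⁻¹ β ∈ D.Φ := by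
    intro g hg β hβ
    have hsurj := Finset.surj_on_of_inj_on_of_card_le (s := D.Φ) (t := D.Φ)
      (fun a _ => g a) hg (fun a b _ _ h => g.injective h) le_rfl β hβ
    obtain ⟨a, ha, hab⟩ := hsurj
    have : g⁻¹ β = a := by
      rw [hab]; exact g.symm_apply_apply a
    rwa [this]
  induction hf using Subgroup.closure_induction with
  | mem f hf =>
    obtain ⟨γ, hγ, h⟩ := hf
    intro β hβ
    rw [h]
    exact D.reflect_mem γ hγ β hβ
  | one => intro β hβ; exact hβ
  | mul f g _ _ hf hg => intro β hβ; exact hf _ (hg _ hβ)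
  | inv f _ hf => exact hinv f hf

lemma tau_theta (D : RootSystemData E)
    (i : Fin D.r) (hlong : ⟪D.α i, D.α i⟫ = 2) (hθ1 : ⟪D.fw i, D.θ⟫ = 1)
    (τ : E ≃ₗ[ℝ] E) (hτW : τ ∈ weylGroup D)
    (hτi : τ (D.α i) = -D.θ)
    (hτj : ∀ j, j ≠ i → ∃ j', j' ≠ i ∧ τ (D.α j) = D.α j') :
    τ D.θ = -D.α i := by
  classical
  set H : E →ₗ[ℝ] ℝ := ∑ j, (sBasis D).coord j with hH
  have hHα : ∀ j, H (D.α j) = 1 := by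
    intro j
    simp [hH, LinearMap.sum_apply, coord_simple, -Module.Basis.coord_apply]
  have hfi : ⟪D.fw i, D.α i⟫ = 1 := by rw [D.fw_def, if_pos rfl, hlong]; norm_num
  have hfj : ∀ j, j ≠ i → ⟪D.fw i, D.α j⟫ = 0 := fun j hj => by
    rw [D.fw_def, if_neg (Ne.symm hj)]
  have hexp : ∀ c : Fin D.r → ℝ, ⟪D.fw i, τ (∑ j, c j • D.α j)⟫ = - c i := by
    intro c
    simp only [map_sum, map_smul, inner_sum, real_inner_smul_right]
    rw [Finset.sum_eq_single i]
    · rw [hτi, inner_neg_right, hθ1]; ring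
    · intro j _ hj
      obtain ⟨j', hj', h⟩ := hτj j hj
      rw [h, hfj j' hj', mul_zero]
    · simp
  have hHexp : ∀ c : Fin D.r → ℝ, H (τ (∑ j, c j • D.α j)) =
      c i * (- H D.θ) + ∑ j ∈ Finset.univ.erase i, c j := by
    intro c
    simp only [map_sum, map_smul, smul_eq_mul]
    rw [← Finset.add_sum_erase _ _ (Finset.mem_univ i), hτi, map_neg]
    congr 1
    refine Finset.sum_congr rfl fun j hj => ?_
    obtain ⟨j', hj', h⟩ := hτj j (Finset.ne_of_mem_erase hj)
    rw [h, hHα, mul_one]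
  obtain ⟨c, hc⟩ := D.θ_pos
  have hci : (c i : ℝ) = 1 := by
    rw [← hθ1, hc, inner_sum, Finset.sum_eq_single i]
    · rw [real_inner_smul_right, hfi, mul_one]
    · intro j _ hj
      rw [real_inner_smul_right, hfj j hj, mul_zero]
    · simp
  have hHθ : H D.θ = 1 + ∑ j ∈ Finset.univ.erase i, (c j : ℝ) := by
    rw [hc, map_sum, ← Finset.add_sum_erase _ _ (Finset.mem_univ i)]
    simp only [map_smul, hHα, smul_eq_mul, mul_one, hci]
  have hinv : τ⁻¹ (D.α i) ∈ D.Φ := weyl_mem D _ (inv_mem hτW) _ (D.base_mem i)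
  obtain ⟨d, hd0, hd⟩ := D.θ_highest _ (root_neg D hinv)
  have hττ : τ (τ⁻¹ (D.α i)) = D.α i := τ.apply_symm_apply _
  have hv : τ (∑ j, d j • D.α j) = τ D.θ + D.α i := by
    rw [← hd, map_sub, map_neg, hττ, sub_neg_eq_add]
  have hdi : d i = 0 := by
    have h1 := hexp d
    have h2 := hexp (fun j => (c j : ℝ))
    rw [← hc] at h2
    rw [hv, inner_add_right, h2, hfi, hci] at h1
    linarith
  have hsum : ∑ j ∈ Finset.univ.erase i, d j = 0 := by
    have h1 := hHexp d
    have h2 := hHexp (fun j => (c j : ℝ))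
    rw [← hc] at h2
    rw [hv, map_add, h2, hHα, hHθ, hci, hdi] at h1
    linarith
  have hall : ∀ j, d j = 0 := by
    intro j
    by_cases hj : j = i
    · rw [hj, hdi]
    · exact (Finset.sum_eq_zero_iff_of_nonneg (fun j _ => hd0 j)).mp hsum j
        (Finset.mem_erase.mpr ⟨hj, Finset.mem_univ j⟩)
  have : τ D.θ + D.α i = 0 := by
    rw [← hv]; simp [hall]
  exact eq_neg_of_add_eq_zero_left this

/-- The affine isometry `φᵢ(γ) = kλᵢ + τᵢ(γ)` normalizes the quantum Weyl group `W₀`,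
and conjugation by it preserves the determinant (`±1`) of the linear part. -/
theorem statement14 (D : RootSystemData E)
    (i : Fin D.r) (hlong : ⟪D.α i, D.α i⟫ = 2) (hθ1 : ⟪D.fw i, D.θ⟫ = 1)
    (τ : E ≃ₗ[ℝ] E) (hτW : τ ∈ weylGroup D)
    (hτi : τ (D.α i) = -D.θ)
    (hτj : ∀ j, j ≠ i → ∃ j', j' ≠ i ∧ τ (D.α j) = D.α j')
    (k : ℕ) (hk : 0 < k)
    (φ : E ≃ᵃⁱ[ℝ] E) (hφ : ∀ x, φ x = (k : ℝ) • D.fw i + τ x) :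
    ∀ σ ∈ qWeylGroup D k, φ * σ * φ⁻¹ ∈ qWeylGroup D k ∧
      LinearMap.det ((φ * σ * φ⁻¹).linearIsometryEquiv.toLinearEquiv.toLinearMap)
        = LinearMap.det (σ.linearIsometryEquiv.toLinearEquiv.toLinearMap) := by
  have hθα := tau_theta D i hlong hθ1 τ hτW hτi hτj
  have hiso : ∀ x y, ⟪τ x, τ y⟫ = ⟪x, y⟫ := by
    have hn : ∀ x, ‖τ x‖ = ‖x‖ := by
      intro x
      have h := φ.dist_map x 0
      rw [hφ, hφ, map_zero, dist_add_left, dist_zero_right, dist_zero_right] at h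
      exact h
    intro x y
    exact LinearIsometry.inner_map_map (⟨τ.toLinearMap, hn⟩ : E →ₗᵢ[ℝ] E) x y
  have hθθ : ⟪D.θ, D.θ⟫ = 2 := by
    rw [← hlong, ← hiso (D.α i), hτi, inner_neg_neg]
  have hfi : ⟪D.fw i, D.α i⟫ = 1 := by rw [D.fw_def, if_pos rfl, hlong]; norm_num
  have hle : qWeylGroup D k ≤ (qWeylGroup D k).comap (MulAut.conj φ).toMonoidHom := by
    conv_lhs => rw [qWeylGroup]
    rw [Subgroup.closure_le]
    intro f hf
    change φ * f * φ⁻¹ ∈ qWeylGroup D k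
    have happ : ∀ x, (φ * f * φ⁻¹) (φ x) = φ (f x) := by
      intro x
      change φ (f (φ.symm (φ x))) = _
      rw [φ.symm_apply_apply]
    rw [qWeylGroup]
    apply Subgroup.subset_closure
    rcases hf with ⟨j, hf⟩ | hf
    · by_cases hj : j = i
      · subst hj
        right
        intro y
        obtain ⟨x, rfl⟩ := φ.surjective y
        rw [happ, hφ (f x), hf, hφ x, map_sub, map_smul, hτi, hlong]
        have h1 : ⟪τ x, D.θ⟫ = - ⟪x, D.α j⟫ := by
          rw [← hiso x, hτi, inner_neg_right, neg_neg]
        rw [inner_add_left, inner_add_left, real_inner_smul_left, hθ1, h1, rho_pair, hlong]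
        module
      · obtain ⟨j', hj', h⟩ := hτj j hj
        left
        refine ⟨j', fun y => ?_⟩
        obtain ⟨x, rfl⟩ := φ.surjective y
        rw [happ, hφ (f x), hf, hφ x, map_sub, map_smul, h]
        have h1 : ⟪τ x, D.α j'⟫ = ⟪x, D.α j⟫ := by rw [← h, hiso]
        have h2 : ⟪D.α j', D.α j'⟫ = ⟪D.α j, D.α j⟫ := by rw [← h, hiso]
        simp only [inner_add_left, real_inner_smul_left]
        rw [D.fw_def, if_neg (Ne.symm hj'), h1, rho_pair, rho_pair, h2]
        module
    · left
      refine ⟨i, fun y => ?_⟩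
      obtain ⟨x, rfl⟩ := φ.surjective y
      have hf' : f x = x - (⟪x, D.θ⟫ - (k + 1)) • D.θ := hf x
      rw [happ, hφ (f x), hf', hφ x, map_sub, map_smul, hθα]
      have h1 : ⟪τ x, D.α i⟫ = - ⟪x, D.θ⟫ := by
        rw [← hiso x, hθα, inner_neg_right, neg_neg]
      simp only [inner_add_left, real_inner_smul_left]
      rw [hfi, h1, rho_pair, hlong]
      module
  intro σ hσ
  refine ⟨hle hσ, ?_⟩
  rw [← LinearMap.det_conj (σ.linearIsometryEquiv.toLinearEquiv.toLinearMap)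
    φ.linearIsometryEquiv.toLinearEquiv]
  rfl
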